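/- arXiv:2301.11346 — 2 statements merged into one kernel-verified Lean document; each statement's English description precedes it below -/
import Mathlib

section
/- Let D and E be k-coalgebras, M a right D-comodule with coaction ρ_M, N a (D,E)-bicomodule with coactions λ_N and ρ_N, and P a left E-comodule with coaction λ_P. Inside M ⊗ N ⊗ P set A = {x : (ρ_M ⊗ id_N ⊗ id_P)(x) = (id_M ⊗ λ_N ⊗ id_P)(x)} and B = {x : (id_M ⊗ ρ_N ⊗ id_P)(x) = (id_M ⊗ id_N ⊗ λ_P)(x)}. Then, using that every k-module is flat so that (M □_D N) ⊗ P and M ⊗ (N □_E P) are submodules of the triple tensor product, the submodule (M □_D N) □_E P of (M □_D N) ⊗ P equals A ∩ B, the submodule M □_D (N □_E P) of M ⊗ (N □_E P) equals A ∩ B, and hence the canonical associativity isomorphism (M ⊗ N) ⊗ P ≅ M ⊗ (N ⊗ P) restricts to a k-linear isomorphism (M □_D N) □_E P ≅ M □_D (N □_E P). -/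
open TensorProduct LinearMap

noncomputable section

structure RightCoaction (k C M : Type*) [CommRing k]
    [AddCommGroup C] [Module k C] [Coalgebra k C]
    [AddCommGroup M] [Module k M] where
  ρ : M →ₗ[k] M ⊗[k] C
  coassoc : TensorProduct.assoc k M C C ∘ₗ ρ.rTensor C ∘ₗ ρ
      = LinearMap.lTensor M (Coalgebra.comul (R := k) (A := C)) ∘ₗ ρ
  counit : LinearMap.lTensor M (Coalgebra.counit (R := k) (A := C)) ∘ₗ ρ
      = (TensorProduct.rid k M).symm.toLinearMap

structure LeftCoaction (k C M : Type*) [CommRing k]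
    [AddCommGroup C] [Module k C] [Coalgebra k C]
    [AddCommGroup M] [Module k M] where
  lam : M →ₗ[k] C ⊗[k] M
  coassoc : TensorProduct.assoc k C C M ∘ₗ
        LinearMap.rTensor M (Coalgebra.comul (R := k) (A := C)) ∘ₗ lam
      = LinearMap.lTensor C lam ∘ₗ lam
  counit : LinearMap.rTensor M (Coalgebra.counit (R := k) (A := C)) ∘ₗ lam
      = (TensorProduct.lid k M).symm.toLinearMap

structure Bicomodule (k C D M : Type*) [CommRing k]
    [AddCommGroup C] [Module k C] [Coalgebra k C]
    [AddCommGroup D] [Module k D] [Coalgebra k D]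
    [AddCommGroup M] [Module k M] where
  left : LeftCoaction k C M
  right : RightCoaction k D M
  compat : TensorProduct.assoc k C M D ∘ₗ LinearMap.rTensor D left.lam ∘ₗ right.ρ
      = LinearMap.lTensor C right.ρ ∘ₗ left.lam

variable {k D E M N P : Type*} [CommRing k] [IsSemisimpleRing k]
  [AddCommGroup D] [Module k D] [Coalgebra k D]
  [AddCommGroup E] [Module k E] [Coalgebra k E]
  [AddCommGroup M] [Module k M]
  [AddCommGroup N] [Module k N]
  [AddCommGroup P] [Module k P]

/-- The cotensor product `M □_D N`. -/
def cotensor (rM : RightCoaction k D M) (lN : LeftCoaction k D N) :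
    Submodule k (M ⊗[k] N) :=
  LinearMap.eqLocus
    ((TensorProduct.assoc k M D N).toLinearMap ∘ₗ LinearMap.rTensor N rM.ρ)
    (LinearMap.lTensor M lN.lam)

/-- The condition `A` inside `(M ⊗ N) ⊗ P`: the cotensor equalizer condition over `D`
between the adjacent factors `M` and `N`. -/
def condA (rM : RightCoaction k D M) (lN : LeftCoaction k D N) :
    Submodule k ((M ⊗[k] N) ⊗[k] P) :=
  LinearMap.eqLocus
    (LinearMap.rTensor P
      ((TensorProduct.assoc k M D N).toLinearMap ∘ₗ LinearMap.rTensor N rM.ρ))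
    (LinearMap.rTensor P (LinearMap.lTensor M lN.lam))

/-- The condition `B` inside `(M ⊗ N) ⊗ P`: the cotensor equalizer condition over `E`
between the adjacent factors `N` and `P`. -/
def condB (rN : RightCoaction k E N) (lP : LeftCoaction k E P) :
    Submodule k ((M ⊗[k] N) ⊗[k] P) :=
  LinearMap.eqLocus
    ((TensorProduct.assoc k (M ⊗[k] N) E P).toLinearMap ∘ₗ
      LinearMap.rTensor P
        ((TensorProduct.assoc k M N E).symm.toLinearMap ∘ₗ LinearMap.lTensor M rN.ρ))
    (LinearMap.lTensor (M ⊗[k] N) lP.lam)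

/-- The condition `A` transported to `M ⊗ (N ⊗ P)`. -/
def condA' (rM : RightCoaction k D M) (lN : LeftCoaction k D N) :
    Submodule k (M ⊗[k] (N ⊗[k] P)) :=
  LinearMap.eqLocus
    (LinearMap.rTensor (N ⊗[k] P) rM.ρ)
    ((TensorProduct.assoc k M D (N ⊗[k] P)).symm.toLinearMap ∘ₗ
      LinearMap.lTensor M
        ((TensorProduct.assoc k D N P).toLinearMap ∘ₗ LinearMap.rTensor P lN.lam))

/-- The condition `B` transported to `M ⊗ (N ⊗ P)`. -/
def condB' (rN : RightCoaction k E N) (lP : LeftCoaction k E P) :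
    Submodule k (M ⊗[k] (N ⊗[k] P)) :=
  LinearMap.eqLocus
    (LinearMap.lTensor M (LinearMap.rTensor P rN.ρ))
    (LinearMap.lTensor M
      ((TensorProduct.assoc k N E P).symm.toLinearMap ∘ₗ LinearMap.lTensor N lP.lam))

/-- `(M □_D N) □_E P` as a submodule of `(M □_D N) ⊗ P`, computed using the corestricted
right `E`-coaction `ρ'` on `M □_D N`. -/
def cotensorLeft (rM : RightCoaction k D M) (BN : Bicomodule k D E N)
    (lP : LeftCoaction k E P)
    (ρ' : ↥(cotensor rM BN.left) →ₗ[k] ↥(cotensor rM BN.left) ⊗[k] E) :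
    Submodule k (↥(cotensor rM BN.left) ⊗[k] P) :=
  LinearMap.eqLocus
    ((TensorProduct.assoc k ↥(cotensor rM BN.left) E P).toLinearMap ∘ₗ
      LinearMap.rTensor P ρ')
    (LinearMap.lTensor ↥(cotensor rM BN.left) lP.lam)

/-- `M □_D (N □_E P)` as a submodule of `M ⊗ (N □_E P)`, computed using the corestricted
left `D`-coaction `λ''` on `N □_E P`. -/
def cotensorRight (rM : RightCoaction k D M) (BN : Bicomodule k D E N)
    (lP : LeftCoaction k E P)
    (lam'' : ↥(cotensor BN.right lP) →ₗ[k] D ⊗[k] ↥(cotensor BN.right lP)) :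
    Submodule k (M ⊗[k] ↥(cotensor BN.right lP)) :=
  LinearMap.eqLocus
    ((TensorProduct.assoc k M D ↥(cotensor BN.right lP)).toLinearMap ∘ₗ
      LinearMap.rTensor ↥(cotensor BN.right lP) rM.ρ)
    (LinearMap.lTensor M lam'')

theorem LinearMap.eqLocus_eq_comap_of_comp_eq {R V W V' W' : Type*} [Semiring R]
    [AddCommMonoid V] [Module R V] [AddCommMonoid W] [Module R W]
    [AddCommMonoid V'] [Module R V'] [AddCommMonoid W'] [Module R W']
    {f g : V →ₗ[R] W} {f' g' : V' →ₗ[R] W'} {i : V →ₗ[R] V'} {j : W →ₗ[R] W'}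
    (hj : Function.Injective j) (hf : j ∘ₗ f = f' ∘ₗ i) (hg : j ∘ₗ g = g' ∘ₗ i) :
    LinearMap.eqLocus f g = (LinearMap.eqLocus f' g').comap i := by
  ext x
  rw [Submodule.mem_comap, LinearMap.mem_eqLocus, LinearMap.mem_eqLocus, ← LinearMap.comp_apply f',
    ← LinearMap.comp_apply g', ← hf, ← hg]
  exact hj.eq_iff.symm

theorem Module.Flat.range_lTensor_eqLocus {R Q V W : Type*} [CommRing R]
    [AddCommGroup Q] [Module R Q] [Module.Flat R Q]
    [AddCommGroup V] [Module R V] [AddCommGroup W] [Module R W] (f g : V →ₗ[R] W) :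
    LinearMap.range (LinearMap.lTensor Q (LinearMap.eqLocus f g).subtype)
      = LinearMap.eqLocus (LinearMap.lTensor Q f) (LinearMap.lTensor Q g) :=
  (Module.Flat.eqLocus_lTensor_eq R Q f g).symm

theorem Module.Flat.range_rTensor_eqLocus {R Q V W : Type*} [CommRing R]
    [AddCommGroup Q] [Module R Q] [Module.Flat R Q]
    [AddCommGroup V] [Module R V] [AddCommGroup W] [Module R W] (f g : V →ₗ[R] W) :
    LinearMap.range (LinearMap.rTensor Q (LinearMap.eqLocus f g).subtype)
      = LinearMap.eqLocus (LinearMap.rTensor Q f) (LinearMap.rTensor Q g) := by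
  rw [LinearMap.eqLocus_eq_ker_sub (LinearMap.rTensor Q f), LinearMap.eqLocus_eq_ker_sub f,
    ← LinearMap.rTensor_sub]
  exact ((Module.Flat.rTensor_exact Q
    (LinearMap.exact_subtype_ker_map (f - g))).linearMap_ker_eq).symm

theorem Module.Flat.of_isSemisimpleRing (R Q : Type*) [CommRing R] [IsSemisimpleRing R]
    [AddCommGroup Q] [Module R Q] : Module.Flat R Q :=
  have := Module.projective_of_isSemisimpleRing R Q
  inferInstance

set_option linter.unusedSectionVars false in
theorem condA_eq_comap_condA' (rM : RightCoaction k D M) (lN : LeftCoaction k D N) :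
    condA (P := P) rM lN
      = (condA' (P := P) rM lN).comap (TensorProduct.assoc k M N P).toLinearMap := by
  refine LinearMap.eqLocus_eq_comap_of_comp_eq
    (j := (TensorProduct.assoc k (M ⊗[k] D) N P).toLinearMap ∘ₗ
      LinearMap.rTensor P (TensorProduct.assoc k M D N).symm.toLinearMap) ?_ ?_ ?_
  · exact ((TensorProduct.congr (TensorProduct.assoc k M D N).symm
      (LinearEquiv.refl k P)).trans (TensorProduct.assoc k (M ⊗[k] D) N P)).injective
  · ext m n p
    simp
  · ext m n p
    simp only [AlgebraTensorModule.curry_apply, restrictScalars_self, curry_apply,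
      LinearMap.comp_apply, LinearEquiv.coe_coe, rTensor_tmul, lTensor_tmul, assoc_tmul]
    generalize lN.lam n = t
    induction t with
    | zero => simp
    | tmul d n' => simp
    | add x y hx hy => simp only [tmul_add, add_tmul, map_add, hx, hy]

set_option linter.unusedSectionVars false in
theorem condB_eq_comap_condB' (rN : RightCoaction k E N) (lP : LeftCoaction k E P) :
    condB (M := M) rN lP
      = (condB' (M := M) rN lP).comap (TensorProduct.assoc k M N P).toLinearMap := by
  refine LinearMap.eqLocus_eq_comap_of_comp_eq
    (j := LinearMap.lTensor M (TensorProduct.assoc k N E P).symm.toLinearMap ∘ₗ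
      (TensorProduct.assoc k M N (E ⊗[k] P)).toLinearMap) ?_ ?_ ?_
  · exact ((TensorProduct.assoc k M N (E ⊗[k] P)).trans
      (TensorProduct.congr (LinearEquiv.refl k M) (TensorProduct.assoc k N E P).symm)).injective
  · ext m n p
    simp only [AlgebraTensorModule.curry_apply, restrictScalars_self, curry_apply,
      LinearMap.comp_apply, LinearEquiv.coe_coe, rTensor_tmul, lTensor_tmul, assoc_tmul]
    generalize rN.ρ n = t
    induction t with
    | zero => simp
    | tmul n' e => simp
    | add x y hx hy => simp only [tmul_add, add_tmul, map_add, hx, hy]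
  · ext m n p
    simp

theorem cotensorLeft_eq_comap_condB (rM : RightCoaction k D M) (BN : Bicomodule k D E N)
    (lP : LeftCoaction k E P)
    (ρ' : ↥(cotensor rM BN.left) →ₗ[k] ↥(cotensor rM BN.left) ⊗[k] E)
    (hρ' : LinearMap.rTensor E (cotensor rM BN.left).subtype ∘ₗ ρ'
      = ((TensorProduct.assoc k M N E).symm.toLinearMap ∘ₗ LinearMap.lTensor M BN.right.ρ)
          ∘ₗ (cotensor rM BN.left).subtype) :
    cotensorLeft rM BN lP ρ' = (condB (M := M) BN.right lP).comap
      (LinearMap.rTensor P (cotensor rM BN.left).subtype) := by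
  have := Module.Flat.of_isSemisimpleRing k (E ⊗[k] P)
  refine LinearMap.eqLocus_eq_comap_of_comp_eq
    (j := LinearMap.rTensor (E ⊗[k] P) (cotensor rM BN.left).subtype)
    ?_ ?_ ?_
  · exact Module.Flat.rTensor_preserves_injective_linearMap _ (Submodule.injective_subtype _)
  · rw [LinearMap.comp_assoc, ← LinearMap.rTensor_comp, ← hρ', LinearMap.rTensor_comp,
      LinearMap.rTensor_tensor]
    ext
    simp
  · rw [LinearMap.rTensor_comp_lTensor, LinearMap.lTensor_comp_rTensor]

theorem cotensorRight_eq_comap_condA' (rM : RightCoaction k D M) (BN : Bicomodule k D E N)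
    (lP : LeftCoaction k E P)
    (lam'' : ↥(cotensor BN.right lP) →ₗ[k] D ⊗[k] ↥(cotensor BN.right lP))
    (hlam'' : LinearMap.lTensor D (cotensor BN.right lP).subtype ∘ₗ lam''
      = ((TensorProduct.assoc k D N P).toLinearMap ∘ₗ LinearMap.rTensor P BN.left.lam)
          ∘ₗ (cotensor BN.right lP).subtype) :
    cotensorRight rM BN lP lam'' = (condA' (P := P) rM BN.left).comap
      (LinearMap.lTensor M (cotensor BN.right lP).subtype) := by
  have := Module.Flat.of_isSemisimpleRing k (M ⊗[k] D)
  refine LinearMap.eqLocus_eq_comap_of_comp_eq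
    (j := LinearMap.lTensor (M ⊗[k] D) (cotensor BN.right lP).subtype ∘ₗ
      (TensorProduct.assoc k M D ↥(cotensor BN.right lP)).symm.toLinearMap) ?_ ?_ ?_
  · exact (Module.Flat.lTensor_preserves_injective_linearMap _
      (Submodule.injective_subtype _)).comp (LinearEquiv.injective _)
  · ext
    simp
  · rw [LinearMap.comp_assoc (LinearMap.lTensor M (cotensor BN.right lP).subtype), ← LinearMap.lTensor_comp, ← hlam'',
      LinearMap.lTensor_comp, LinearMap.lTensor_tensor]
    ext
    simp

theorem range_rTensor_cotensor (rM : RightCoaction k D M) (lN : LeftCoaction k D N) :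
    LinearMap.range (LinearMap.rTensor P (cotensor rM lN).subtype) = condA (P := P) rM lN :=
  have := Module.Flat.of_isSemisimpleRing k P
  Module.Flat.range_rTensor_eqLocus _ _

theorem range_lTensor_cotensor (rN : RightCoaction k E N) (lP : LeftCoaction k E P) :
    LinearMap.range (LinearMap.lTensor M (cotensor rN lP).subtype) = condB' (M := M) rN lP := by
  have := Module.Flat.of_isSemisimpleRing k M
  refine (Module.Flat.range_lTensor_eqLocus _ _).trans ?_
  refine (LinearMap.eqLocus_eq_comap_of_comp_eq (i := LinearMap.id)
    (j := LinearMap.lTensor M (TensorProduct.assoc k N E P).symm.toLinearMap)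
    (TensorProduct.congr (LinearEquiv.refl k M) (TensorProduct.assoc k N E P).symm).injective
    ?_ ?_).trans (Submodule.comap_id _)
  · rw [← LinearMap.lTensor_comp, ← LinearMap.comp_assoc]
    simp
  · rw [← LinearMap.lTensor_comp]
    simp

/-- Associativity of the cotensor product: `(M □_D N) ⊗ P` and `M ⊗ (N □_E P)` are
submodules of the triple tensor product, the submodules `(M □_D N) □_E P` and
`M □_D (N □_E P)` both equal `A ∩ B`, and hence the canonical associativity isomorphism
restricts to a `k`-linear isomorphism `(M □_D N) □_E P ≅ M □_D (N □_E P)`. -/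
theorem cotensor_assoc (rM : RightCoaction k D M) (BN : Bicomodule k D E N)
    (lP : LeftCoaction k E P)
    (ρ' : ↥(cotensor rM BN.left) →ₗ[k] ↥(cotensor rM BN.left) ⊗[k] E)
    (hρ' : LinearMap.rTensor E (cotensor rM BN.left).subtype ∘ₗ ρ'
      = ((TensorProduct.assoc k M N E).symm.toLinearMap ∘ₗ LinearMap.lTensor M BN.right.ρ)
          ∘ₗ (cotensor rM BN.left).subtype)
    (lam'' : ↥(cotensor BN.right lP) →ₗ[k] D ⊗[k] ↥(cotensor BN.right lP))
    (hlam'' : LinearMap.lTensor D (cotensor BN.right lP).subtype ∘ₗ lam''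
      = ((TensorProduct.assoc k D N P).toLinearMap ∘ₗ LinearMap.rTensor P BN.left.lam)
          ∘ₗ (cotensor BN.right lP).subtype) :
    Function.Injective (LinearMap.rTensor P (cotensor rM BN.left).subtype) ∧
    Function.Injective (LinearMap.lTensor M (cotensor BN.right lP).subtype) ∧
    Submodule.map (LinearMap.rTensor P (cotensor rM BN.left).subtype)
        (cotensorLeft rM BN lP ρ')
      = condA (P := P) rM BN.left ⊓ condB (M := M) BN.right lP ∧
    Submodule.map (LinearMap.lTensor M (cotensor BN.right lP).subtype)
        (cotensorRight rM BN lP lam'')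
      = condA' (P := P) rM BN.left ⊓ condB' (M := M) BN.right lP ∧
    Submodule.map (TensorProduct.assoc k M N P).toLinearMap
        (condA (P := P) rM BN.left ⊓ condB (M := M) BN.right lP)
      = condA' (P := P) rM BN.left ⊓ condB' (M := M) BN.right lP ∧
    ∃ e : ↥(cotensorLeft rM BN lP ρ') ≃ₗ[k] ↥(cotensorRight rM BN lP lam''),
      ∀ x : ↥(cotensorLeft rM BN lP ρ'),
        LinearMap.lTensor M (cotensor BN.right lP).subtype
            ((e x : M ⊗[k] ↥(cotensor BN.right lP)))
          = TensorProduct.assoc k M N P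
              (LinearMap.rTensor P (cotensor rM BN.left).subtype
                (x : ↥(cotensor rM BN.left) ⊗[k] P)) := by
  have := Module.Flat.of_isSemisimpleRing k P
  have := Module.Flat.of_isSemisimpleRing k M
  have hi : Function.Injective (LinearMap.rTensor P (cotensor rM BN.left).subtype) :=
    Module.Flat.rTensor_preserves_injective_linearMap _ (Submodule.injective_subtype _)
  have hj : Function.Injective (LinearMap.lTensor M (cotensor BN.right lP).subtype) :=
    Module.Flat.lTensor_preserves_injective_linearMap _ (Submodule.injective_subtype _)
  have hL : Submodule.map (LinearMap.rTensor P (cotensor rM BN.left).subtype)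
      (cotensorLeft rM BN lP ρ') = condA (P := P) rM BN.left ⊓ condB (M := M) BN.right lP := by
    rw [cotensorLeft_eq_comap_condB rM BN lP ρ' hρ', Submodule.map_comap_eq,
      range_rTensor_cotensor]
  have hR : Submodule.map (LinearMap.lTensor M (cotensor BN.right lP).subtype)
      (cotensorRight rM BN lP lam'')
        = condA' (P := P) rM BN.left ⊓ condB' (M := M) BN.right lP := by
    rw [cotensorRight_eq_comap_condA' rM BN lP lam'' hlam'', Submodule.map_comap_eq,
      range_lTensor_cotensor, inf_comm]
  have hAB : Submodule.map (TensorProduct.assoc k M N P).toLinearMap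
      (condA (P := P) rM BN.left ⊓ condB (M := M) BN.right lP)
        = condA' (P := P) rM BN.left ⊓ condB' (M := M) BN.right lP := by
    rw [condA_eq_comap_condA', condB_eq_comap_condB', ← Submodule.comap_inf]
    exact Submodule.map_comap_eq_of_surjective (TensorProduct.assoc k M N P).surjective _
  refine ⟨hi, hj, hL, hR, hAB, ?_⟩
  let e := ((Submodule.equivMapOfInjective _ hi (cotensorLeft rM BN lP ρ')).trans
    ((TensorProduct.assoc k M N P).submoduleMap _)).trans
      ((LinearEquiv.ofEq _ _ (by rw [hL, hR]; exact hAB)).trans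
        (Submodule.equivMapOfInjective _ hj (cotensorRight rM BN lP lam'')).symm)
  refine ⟨e, fun x => ?_⟩
  rw [← Submodule.coe_equivMapOfInjective_apply _ hj]
  simp [e]

end
end

section
/- Let C and D be k-coalgebras, M a (C,D)-bicomodule and N a (D,C)-bicomodule, and equip M □_D N and N □_C M with their induced (C,C)- and (D,D)-bicomodule structures (corestrictions of λ_M ⊗ id_N, id_M ⊗ ρ_N, and of λ_N ⊗ id_M, id_N ⊗ ρ_M, respectively). Suppose there exist a (C,C)-bicolinear k-linear isomorphism η : C ≅ M □_D N (C carrying coactions Δ_C on both sides) and a (D,D)-bicolinear k-linear isomorphism ξ : N □_C M ≅ D (D carrying coactions Δ_D on both sides). Then there is a k-linear isomorphism coHH_0(C) ≅ coHH_0(D). -/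
open TensorProduct LinearMap

noncomputable section

variable {k C D M N : Type*} [CommRing k] [IsSemisimpleRing k]
  [AddCommGroup C] [Module k C] [Coalgebra k C]
  [AddCommGroup D] [Module k D] [Coalgebra k D]
  [AddCommGroup M] [Module k M]
  [AddCommGroup N] [Module k N]

/-- `coHH_0` of a coalgebra: the kernel of `Δ − τ ∘ Δ`. -/
def coHH0 (k C : Type*) [CommRing k] [AddCommGroup C] [Module k C] [Coalgebra k C] :
    Submodule k C :=
  LinearMap.eqLocus (Coalgebra.comul (R := k) (A := C))
    ((TensorProduct.comm k C C).toLinearMap ∘ₗ Coalgebra.comul (R := k) (A := C))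

/-- Let `η : C ≅ M □_D N` be bicolinear. Then `c ∈ coHH_0(C)` if and only if the image of `η c`
under the swap `M ⊗ N ≅ N ⊗ M` lies in `N □_C M`. -/
theorem mem_coHH0_iff_comm_mem_cotensor
    (BM : Bicomodule k C D M) (BN : Bicomodule k D C N)
    (lam' : ↥(cotensor BM.right BN.left) →ₗ[k] C ⊗[k] ↥(cotensor BM.right BN.left))
    (rho' : ↥(cotensor BM.right BN.left) →ₗ[k] ↥(cotensor BM.right BN.left) ⊗[k] C)
    (hlam' : LinearMap.lTensor C (cotensor BM.right BN.left).subtype ∘ₗ lam'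
      = ((TensorProduct.assoc k C M N).toLinearMap ∘ₗ LinearMap.rTensor N BM.left.lam)
          ∘ₗ (cotensor BM.right BN.left).subtype)
    (hrho' : LinearMap.rTensor C (cotensor BM.right BN.left).subtype ∘ₗ rho'
      = ((TensorProduct.assoc k M N C).symm.toLinearMap ∘ₗ LinearMap.lTensor M BN.right.ρ)
          ∘ₗ (cotensor BM.right BN.left).subtype)
    (η : C ≃ₗ[k] ↥(cotensor BM.right BN.left))
    (hηl : lam' ∘ₗ η.toLinearMap
      = LinearMap.lTensor C η.toLinearMap ∘ₗ Coalgebra.comul (R := k) (A := C))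
    (hηr : rho' ∘ₗ η.toLinearMap
      = LinearMap.rTensor C η.toLinearMap ∘ₗ Coalgebra.comul (R := k) (A := C))
    (c : C) :
    c ∈ coHH0 k C ↔
      TensorProduct.comm k M N (η c : M ⊗[k] N) ∈ cotensor BN.right BM.left := by
  have : Module.Projective k C := Module.projective_of_isSemisimpleRing k C
  set i : C →ₗ[k] M ⊗[k] N := (cotensor BM.right BN.left).subtype ∘ₗ η.toLinearMap with hi
  have hinj : Function.Injective (LinearMap.lTensor C i) :=
    Module.Flat.lTensor_preserves_injective_linearMap i
      ((Submodule.subtype_injective _).comp η.injective)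
  have hl : LinearMap.lTensor C i (Coalgebra.comul (R := k) c)
      = TensorProduct.assoc k C M N (LinearMap.rTensor N BM.left.lam (η c)) := by
    have h₁ := LinearMap.congr_fun hηl c
    have h₂ := LinearMap.congr_fun hlam' (η c)
    simp only [LinearMap.comp_apply, LinearEquiv.coe_coe, Submodule.subtype_apply] at h₁ h₂
    rw [hi, LinearMap.lTensor_comp, LinearMap.comp_apply, ← h₁, h₂]
  have hr : LinearMap.rTensor C i (Coalgebra.comul (R := k) c)
      = (TensorProduct.assoc k M N C).symm (LinearMap.lTensor M BN.right.ρ (η c)) := by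
    have h₁ := LinearMap.congr_fun hηr c
    have h₂ := LinearMap.congr_fun hrho' (η c)
    simp only [LinearMap.comp_apply, LinearEquiv.coe_coe, Submodule.subtype_apply] at h₁ h₂
    rw [hi, LinearMap.rTensor_comp, LinearMap.comp_apply, ← h₁, h₂]
  let e : C ⊗[k] (M ⊗[k] N) ≃ₗ[k] N ⊗[k] (C ⊗[k] M) :=
    (TensorProduct.assoc k C M N).symm ≪≫ₗ TensorProduct.comm k (C ⊗[k] M) N
  have hcyc (y : M ⊗[k] (N ⊗[k] C)) :
      e (TensorProduct.comm k (M ⊗[k] N) C ((TensorProduct.assoc k M N C).symm y))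
        = TensorProduct.assoc k N C M (TensorProduct.comm k M (N ⊗[k] C) y) := by
    suffices h : (e.toLinearMap ∘ₗ (TensorProduct.comm k (M ⊗[k] N) C).toLinearMap ∘ₗ
        (TensorProduct.assoc k M N C).symm.toLinearMap)
        = (TensorProduct.assoc k N C M).toLinearMap ∘ₗ
          (TensorProduct.comm k M (N ⊗[k] C)).toLinearMap from LinearMap.congr_fun h y
    ext
    simp [e]
  have hcomm : LinearMap.lTensor C i (TensorProduct.comm k C C (Coalgebra.comul (R := k) c))
      = TensorProduct.comm k (M ⊗[k] N) C
          (LinearMap.rTensor C i (Coalgebra.comul (R := k) c)) :=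
    LinearMap.lTensor_comm ..
  simp only [coHH0, cotensor, LinearMap.mem_eqLocus, LinearMap.comp_apply, LinearEquiv.coe_coe]
  rw [← hinj.eq_iff, hcomm, hl, hr, ← e.injective.eq_iff, hcyc]
  simp only [e, LinearEquiv.trans_apply, LinearEquiv.symm_apply_apply, LinearMap.lTensor_comm,
    LinearMap.rTensor_comm]
  exact eq_comm

/-- Morita--Takeuchi invariance of `coHH₀`: if `C ≅ M □_D N` as `(C,C)`-bicomodules and
`N □_C M ≅ D` as `(D,D)`-bicomodules (via the induced bicomodule structures on the
cotensor products), then `coHH_0(C) ≅ coHH_0(D)`. -/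
theorem coHH0_morita_takeuchi_invariance
    (BM : Bicomodule k C D M) (BN : Bicomodule k D C N)
    -- the induced `(C,C)`-bicomodule structure on `M □_D N`
    (lam' : ↥(cotensor BM.right BN.left) →ₗ[k] C ⊗[k] ↥(cotensor BM.right BN.left))
    (rho' : ↥(cotensor BM.right BN.left) →ₗ[k] ↥(cotensor BM.right BN.left) ⊗[k] C)
    (hlam' : LinearMap.lTensor C (cotensor BM.right BN.left).subtype ∘ₗ lam'
      = ((TensorProduct.assoc k C M N).toLinearMap ∘ₗ LinearMap.rTensor N BM.left.lam)
          ∘ₗ (cotensor BM.right BN.left).subtype)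
    (hrho' : LinearMap.rTensor C (cotensor BM.right BN.left).subtype ∘ₗ rho'
      = ((TensorProduct.assoc k M N C).symm.toLinearMap ∘ₗ LinearMap.lTensor M BN.right.ρ)
          ∘ₗ (cotensor BM.right BN.left).subtype)
    -- the induced `(D,D)`-bicomodule structure on `N □_C M`
    (lam'' : ↥(cotensor BN.right BM.left) →ₗ[k] D ⊗[k] ↥(cotensor BN.right BM.left))
    (rho'' : ↥(cotensor BN.right BM.left) →ₗ[k] ↥(cotensor BN.right BM.left) ⊗[k] D)
    (hlam'' : LinearMap.lTensor D (cotensor BN.right BM.left).subtype ∘ₗ lam''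
      = ((TensorProduct.assoc k D N M).toLinearMap ∘ₗ LinearMap.rTensor M BN.left.lam)
          ∘ₗ (cotensor BN.right BM.left).subtype)
    (hrho'' : LinearMap.rTensor D (cotensor BN.right BM.left).subtype ∘ₗ rho''
      = ((TensorProduct.assoc k N M D).symm.toLinearMap ∘ₗ LinearMap.lTensor N BM.right.ρ)
          ∘ₗ (cotensor BN.right BM.left).subtype)
    -- a `(C,C)`-bicolinear isomorphism `η : C ≅ M □_D N`
    (η : C ≃ₗ[k] ↥(cotensor BM.right BN.left))
    (hηl : lam' ∘ₗ η.toLinearMap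
      = LinearMap.lTensor C η.toLinearMap ∘ₗ Coalgebra.comul (R := k) (A := C))
    (hηr : rho' ∘ₗ η.toLinearMap
      = LinearMap.rTensor C η.toLinearMap ∘ₗ Coalgebra.comul (R := k) (A := C))
    -- a `(D,D)`-bicolinear isomorphism `ξ : N □_C M ≅ D`
    (ξ : ↥(cotensor BN.right BM.left) ≃ₗ[k] D)
    (hξl : Coalgebra.comul (R := k) (A := D) ∘ₗ ξ.toLinearMap
      = LinearMap.lTensor D ξ.toLinearMap ∘ₗ lam'')
    (hξr : Coalgebra.comul (R := k) (A := D) ∘ₗ ξ.toLinearMap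
      = LinearMap.rTensor D ξ.toLinearMap ∘ₗ rho'') :
    Nonempty (↥(coHH0 k C) ≃ₗ[k] ↥(coHH0 k D)) := by
  have hξl' : lam'' ∘ₗ ξ.symm.toLinearMap
      = LinearMap.lTensor D ξ.symm.toLinearMap ∘ₗ Coalgebra.comul (R := k) (A := D) := by
    rw [← LinearMap.cancel_right ξ.surjective, LinearMap.comp_assoc, LinearMap.comp_assoc, hξl,
      ← LinearMap.comp_assoc _ _ (LinearMap.lTensor D _), ← LinearMap.lTensor_comp]
    simp
  have hξr' : rho'' ∘ₗ ξ.symm.toLinearMap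
      = LinearMap.rTensor D ξ.symm.toLinearMap ∘ₗ Coalgebra.comul (R := k) (A := D) := by
    rw [← LinearMap.cancel_right ξ.surjective, LinearMap.comp_assoc, LinearMap.comp_assoc, hξr,
      ← LinearMap.comp_assoc _ _ (LinearMap.rTensor D _), ← LinearMap.rTensor_comp]
    simp
  have hC := mem_coHH0_iff_comm_mem_cotensor BM BN lam' rho' hlam' hrho' η hηl hηr
  have hD := mem_coHH0_iff_comm_mem_cotensor BN BM lam'' rho'' hlam'' hrho'' ξ.symm hξl' hξr'
  exact ⟨
    { toFun := fun c => ⟨ξ ⟨TensorProduct.comm k M N (η c), (hC c).1 c.2⟩, (hD _).2 (by simp)⟩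
      invFun := fun d =>
        ⟨η.symm ⟨TensorProduct.comm k N M (ξ.symm d), (hD d).1 d.2⟩, (hC _).2 (by simp)⟩
      map_add' := fun c c' => by
        refine Subtype.ext ((congrArg ξ (Subtype.ext ?_)).trans (map_add ξ _ _))
        simp
      map_smul' := fun r c => by
        refine Subtype.ext ((congrArg ξ (Subtype.ext ?_)).trans (map_smul ξ r _))
        simp
      left_inv := fun c => by simp
      right_inv := fun d => by simp }⟩

end
end
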